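/- arXiv:2312.07377 — 3 statements merged into one kernel-verified Lean document; each statement's English description precedes it below -/
import Mathlib

section
/- Let G be a connected finite simple graph on n ≥ 3 vertices and k ≥ 0 an integer. Then γ̈_P^k(G) ≤ (k+1)·(n/3). -/
/-- A set `T` of observed vertices is closed under the zero forcing rule:
if an observed vertex `v` has exactly one unobserved neighbor `w`,
then `w` becomes observed. -/
def ForcingClosed {V : Type*} (G : SimpleGraph V) (T : Set V) : Prop :=
  ∀ v ∈ T, ∀ w, G.Adj v w → (∀ u, G.Adj v u → u ∉ T → u = w) → w ∈ T

/-- The set of vertices observed by the power domination process started at `S`: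
the smallest set containing the closed neighborhood of `S` (domination step)
and closed under zero forcing. -/
def observedSet {V : Type*} (G : SimpleGraph V) (S : Set V) : Set V :=
  ⋂₀ {T : Set V | (∀ s ∈ S, s ∈ T ∧ ∀ w, G.Adj s w → w ∈ T) ∧ ForcingClosed G T}

/-- `S` is a power dominating set if the process observes every vertex. -/
def IsPDS {V : Type*} (G : SimpleGraph V) (S : Set V) : Prop :=
  observedSet G S = Set.univ

/-- The power domination number: minimum cardinality of a power dominating set. -/
noncomputable def pdn {V : Type*} (G : SimpleGraph V) : ℕ :=
  sInf {n | ∃ S : Finset V, S.card = n ∧ IsPDS G ↑S}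

/-- A multiset `S` of PMUs is a `k`-PMU-defect-robust power dominating set:
for every submultiset `F` of `S` with `|F| = k`, the underlying set of
`S - F` is a power dominating set. -/
def IsKrPDS {V : Type*} (G : SimpleGraph V) (k : ℕ) (S : Multiset V) : Prop :=
  letI := Classical.decEq V
  ∀ F : Multiset V, F ≤ S → Multiset.card F = k → IsPDS G {v | v ∈ S - F}

/-- The `k`-PMU-defect-robust power domination number. -/
noncomputable def rpdn {V : Type*} (G : SimpleGraph V) (k : ℕ) : ℕ :=
  sInf {n | ∃ S : Multiset V, Multiset.card S = n ∧ IsKrPDS G k S}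

/-- If every forcing-closed set containing `N[U]` contains `N[S]`, then `U` is power dominating
whenever `S` is. -/
theorem IsPDS.of_forall_dominates {V : Type*} {G : SimpleGraph V} {S U : Set V} (hS : IsPDS G S)
    (h : ∀ T : Set V, (∀ s ∈ U, s ∈ T ∧ ∀ w, G.Adj s w → w ∈ T) → ForcingClosed G T →
      ∀ s ∈ S, s ∈ T ∧ ∀ w, G.Adj s w → w ∈ T) : IsPDS G U := by
  refine Set.eq_univ_of_forall fun x T hT => ?_
  have hx : x ∈ observedSet G S := by rw [hS]; trivial
  exact hx T ⟨h T hT.1 hT.2, hT.2⟩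

theorem IsPDS.mono {V : Type*} {G : SimpleGraph V} {S U : Set V} (hS : IsPDS G S)
    (h : S ⊆ U) : IsPDS G U :=
  hS.of_forall_dominates fun _ hT _ s hs => hT s (h hs)

theorem isPDS_univ {V : Type*} (G : SimpleGraph V) : IsPDS G Set.univ :=
  Set.eq_univ_of_forall fun x _ hT => (hT.1 x trivial).1

/-- `x` is an external private neighbor of `v` with respect to `S`. -/
def IsExternalPrivate {V : Type*} (G : SimpleGraph V) (S : Set V) (v x : V) : Prop :=
  x ∉ S ∧ G.Adj v x ∧ ∀ s ∈ S, G.Adj s x → s = v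

/-- A vertex of a power dominating set with at most one external private neighbor can be
discarded as soon as it is dominated by the remaining vertices. -/
theorem IsPDS.discard {V : Type*} {G : SimpleGraph V} {S U : Set V} {v : V} (hS : IsPDS G S)
    (hv : {x | IsExternalPrivate G S v x}.Subsingleton) (hSU : ∀ s ∈ S, s ≠ v → s ∈ U)
    (hU : ∃ u ∈ U, G.Adj u v) : IsPDS G U := by
  refine hS.of_forall_dominates fun T hT hc s hs => ?_
  by_cases hsv : s = v
  · subst hsv
    obtain ⟨u, hu, hus⟩ := hU
    have hsT : s ∈ T := (hT u hu).2 s hus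
    have key : ∀ x, G.Adj s x → x ∉ T → IsExternalPrivate G S s x := by
      refine fun x hsx hx => ⟨fun hxS => hx (hT x (hSU x hxS hsx.ne')).1, hsx, fun t ht htx => ?_⟩
      by_contra hne
      exact hx ((hT t (hSU t ht hne)).2 x htx)
    refine ⟨hsT, fun w hw => ?_⟩
    by_contra hwT
    exact hwT (hc s hsT w hw fun y hy hyT => hv (key y hy hyT) (key w hw hwT))
  · exact hT s (hSU s hs hsv)

theorem SimpleGraph.Connected.mem_of_adj_closed {V : Type*} {G : SimpleGraph V}
    (hG : G.Connected) {A : Set V} {a : V} (ha : a ∈ A)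
    (hA : ∀ x ∈ A, ∀ y, G.Adj x y → y ∈ A) (b : V) : b ∈ A := by
  have h := (SimpleGraph.reachable_iff_reflTransGen a b).1 (hG.preconnected a b)
  induction h with
  | refl => exact ha
  | tail _ hxy ih => exact hA _ ih _ hxy

open Classical in
/-- The penalty of `s` relative to `S`: zero if `s` has a neighbor in `S`, and otherwise one or
two according to whether `s` has at least two neighbors in `G`. -/
noncomputable def isolationPenalty {V : Type*} (G : SimpleGraph V) (S : Finset V) (s : V) : ℕ :=
  if ∃ t ∈ S, G.Adj s t then 0 else if ∃ a b, a ≠ b ∧ G.Adj s a ∧ G.Adj s b then 1 else 2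

open Classical in
theorem sum_isolationPenalty_swap_lt {V : Type*} {G : SimpleGraph V} {S : Finset V} {u v : V}
    (hv : v ∈ S) (hiso : ∀ t ∈ S, ¬ G.Adj v t) (hu : u ∉ S)
    (hlt : isolationPenalty G (insert u (S.erase v)) u < isolationPenalty G S v) :
    ∑ s ∈ insert u (S.erase v), isolationPenalty G (insert u (S.erase v)) s <
      ∑ s ∈ S, isolationPenalty G S s := by
  rw [Finset.sum_insert (fun h => hu (Finset.mem_of_mem_erase h)), ← Finset.add_sum_erase S _ hv]
  refine add_lt_add_of_lt_of_le hlt (Finset.sum_le_sum fun s hs => ?_)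
  have hsS := Finset.mem_of_mem_erase hs
  by_cases h : ∃ t ∈ S, G.Adj s t
  · obtain ⟨t, ht, hst⟩ := h
    have htv : t ≠ v := by rintro rfl; exact hiso s hsS hst.symm
    have h' : ∃ t ∈ insert u (S.erase v), G.Adj s t :=
      ⟨t, Finset.mem_insert_of_mem (Finset.mem_erase.2 ⟨htv, ht⟩), hst⟩
    simp only [isolationPenalty, if_pos h', zero_le]
  · unfold isolationPenalty
    rw [if_neg h]
    split_ifs <;> omega

open Classical in
/-- A connected graph on at least three vertices has a power dominating set each of whose
members has at least two external private neighbors. -/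
theorem exists_isPDS_externalPrivate {V : Type*} [Fintype V] {G : SimpleGraph V}
    (hG : G.Connected) (hn : 3 ≤ Fintype.card V) :
    ∃ S : Finset V, IsPDS G S ∧ ∀ v ∈ S, {x | IsExternalPrivate G S v x}.Nontrivial := by
  obtain ⟨S, hS, hmin⟩ := Finset.exists_min_image
    (Finset.univ.filter fun S : Finset V => IsPDS G S)
    (fun S => toLex (S.card, ∑ s ∈ S, isolationPenalty G S s))
    ⟨Finset.univ, by simpa using isPDS_univ G⟩
  simp only [Finset.mem_filter, Finset.mem_univ, true_and] at hS hmin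
  refine ⟨S, hS, fun v hv => ?_⟩
  by_contra hnt
  have hsub : {x | IsExternalPrivate G S v x}.Subsingleton := Set.not_nontrivial_iff.1 hnt
  by_cases hadj : ∃ t ∈ S, G.Adj v t
  · obtain ⟨t, ht, hvt⟩ := hadj
    have hP : IsPDS G (S.erase v : Finset V) :=
      hS.discard hsub (fun s hs hsv => Finset.mem_coe.2 (Finset.mem_erase.2 ⟨hsv, hs⟩))
        ⟨t, Finset.mem_coe.2 (Finset.mem_erase.2 ⟨hvt.ne', ht⟩), hvt.symm⟩
    have hle := hmin _ hP
    have hlt := Finset.card_erase_lt_of_mem hv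
    rw [Prod.Lex.toLex_le_toLex] at hle
    dsimp only at hle
    omega
  have hiso : ∀ t ∈ S, ¬ G.Adj v t := fun t ht h => hadj ⟨t, ht, h⟩
  have hswap : ∀ u, G.Adj v u →
      isolationPenalty G S v ≤ isolationPenalty G (insert u (S.erase v)) u := by
    intro u hvu
    by_contra hlt
    have hu : u ∉ S := fun h => hiso u h hvu
    have hP : IsPDS G (insert u (S.erase v) : Finset V) :=
      hS.discard hsub
        (fun s hs hsv => Finset.mem_coe.2
          (Finset.mem_insert_of_mem (Finset.mem_erase.2 ⟨hsv, hs⟩)))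
        ⟨u, Finset.mem_coe.2 (Finset.mem_insert_self _ _), hvu.symm⟩
    have hle := hmin _ hP
    have hsum := sum_isolationPenalty_swap_lt hv hiso hu (not_le.1 hlt)
    have hcard : (insert u (S.erase v)).card = S.card := by
      rw [Finset.card_insert_of_notMem (fun h => hu (Finset.mem_of_mem_erase h)),
        Finset.card_erase_add_one hv]
    rw [Prod.Lex.toLex_le_toLex] at hle
    dsimp only at hle
    omega
  have hext : ∀ u, G.Adj v u → IsExternalPrivate G S v u := by
    refine fun u hvu => ⟨fun h => hiso u h hvu, hvu, fun s hs hsu => ?_⟩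
    by_contra hsv
    have h := hswap u hvu
    have h' : ∃ t ∈ insert u (S.erase v), G.Adj u t :=
      ⟨s, Finset.mem_insert_of_mem (Finset.mem_erase.2 ⟨hsv, hs⟩), hsu.symm⟩
    rw [isolationPenalty, isolationPenalty, if_pos h', if_neg hadj] at h
    split_ifs at h <;> omega
  obtain ⟨w, hvw⟩ : ∃ w, G.Adj v w := by
    by_contra! h
    obtain ⟨b, hb⟩ := Finset.exists_mem_notMem_of_card_lt_card
      (s := {v}) (t := Finset.univ) (by rw [Finset.card_univ, Finset.card_singleton]; omega)
    refine hb.2 (Finset.mem_singleton.2 (hG.mem_of_adj_closed (A := {v}) rfl ?_ b))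
    rintro x rfl y hxy
    exact absurd hxy (h y)
  have hleaf : ∀ u, G.Adj v u → u = w := fun u hvu => hsub (hext u hvu) (hext w hvw)
  obtain ⟨y, hwy, hyv⟩ : ∃ y, G.Adj w y ∧ y ≠ v := by
    by_contra! h
    obtain ⟨b, hb⟩ := Finset.exists_mem_notMem_of_card_lt_card
      (s := {v, w}) (t := Finset.univ)
      (lt_of_le_of_lt Finset.card_le_two (by rw [Finset.card_univ]; omega))
    have hbm := hG.mem_of_adj_closed (A := {v, w}) (Set.mem_insert v {w}) ?_ b
    · exact hb.2 (by simpa using hbm)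
    · rintro x (rfl | rfl) z hxz
      · exact Or.inr (hleaf z hxz)
      · exact Or.inl (h z hxz)
  have h := hswap w hvw
  have h₁ : ¬ ∃ a b, a ≠ b ∧ G.Adj v a ∧ G.Adj v b := by
    rintro ⟨a, b, hab, ha, hb⟩
    exact hab ((hleaf a ha).trans (hleaf b hb).symm)
  have h₂ : ∃ a b, a ≠ b ∧ G.Adj w a ∧ G.Adj w b := ⟨y, v, hyv, hwy, hvw.symm⟩
  rw [isolationPenalty, isolationPenalty, if_neg hadj, if_neg h₁, if_pos h₂] at h
  split_ifs at h <;> omega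

open Classical in
/-- A connected graph on `n ≥ 3` vertices has a power dominating set of size at most `n / 3`. -/
theorem exists_isPDS_three_mul_card_le {V : Type*} [Fintype V] {G : SimpleGraph V}
    (hG : G.Connected) (hn : 3 ≤ Fintype.card V) :
    ∃ S : Finset V, IsPDS G S ∧ 3 * S.card ≤ Fintype.card V := by
  obtain ⟨S, hS, hpriv⟩ := exists_isPDS_externalPrivate hG hn
  refine ⟨S, hS, ?_⟩
  let P : V → Finset V := fun v => Finset.univ.filter fun x => x = v ∨ IsExternalPrivate G S v x
  have hdisj : Set.PairwiseDisjoint (S : Set V) P := by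
    intro v hv w hw hvw
    refine Finset.disjoint_left.2 fun x hxv hxw => hvw ?_
    simp only [P, Finset.mem_filter, Finset.mem_univ, true_and] at hxv hxw
    rcases hxv with rfl | hxv <;> rcases hxw with rfl | hxw
    · rfl
    · exact absurd hv hxw.1
    · exact absurd hw hxv.1
    · exact hxw.2.2 v hv hxv.2.1
  have hcard : ∀ v ∈ S, 3 ≤ (P v).card := by
    intro v hv
    obtain ⟨a, ha, b, hb, hab⟩ := hpriv v hv
    refine Finset.two_lt_card.2 ⟨v, ?_, a, ?_, b, ?_, ha.2.1.ne, hb.2.1.ne, hab⟩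
    · simp [P]
    · exact Finset.mem_filter.2 ⟨Finset.mem_univ _, Or.inr ha⟩
    · exact Finset.mem_filter.2 ⟨Finset.mem_univ _, Or.inr hb⟩
  calc 3 * S.card = S.card • 3 := by rw [smul_eq_mul, mul_comm]
    _ ≤ ∑ v ∈ S, (P v).card := Finset.card_nsmul_le_sum S _ 3 hcard
    _ = (S.biUnion P).card := (Finset.card_biUnion hdisj).symm
    _ ≤ Fintype.card V := Finset.card_le_univ _

/-- Taking `k + 1` copies of a power dominating set yields a `k`-robust one. -/
theorem IsPDS.isKrPDS_nsmul {V : Type*} {G : SimpleGraph V} {S : Finset V} (hS : IsPDS G S)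
    (k : ℕ) : IsKrPDS G k ((k + 1) • S.val) := by
  classical
  intro F _ hF
  refine hS.mono fun v hv => ?_
  have hvS : 1 ≤ S.val.count v := Multiset.one_le_count_iff_mem.2 hv
  have hvF : F.count v ≤ k := hF ▸ Multiset.count_le_card v F
  have hmul : k + 1 ≤ (k + 1) * S.val.count v := Nat.le_mul_of_pos_right _ hvS
  rw [Set.mem_ofPred_eq, Multiset.mem_sub, Multiset.count_nsmul]
  convert lt_of_le_of_lt hvF (Nat.lt_of_succ_le hmul)

/-- Corollary: if `G` is connected on `n ≥ 3` vertices and `k ≥ 0`, then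
`γ̈_P^k(G) ≤ (k+1)·n/3`. -/
theorem rpdn_le_third {V : Type*} [Fintype V] (G : SimpleGraph V) (k : ℕ)
    (hconn : G.Connected) (hn : 3 ≤ Fintype.card V) :
    (rpdn G k : ℚ) ≤ (k + 1) * (Fintype.card V : ℚ) / 3 := by
  obtain ⟨S, hS, hcard⟩ := exists_isPDS_three_mul_card_le hconn hn
  have hle : rpdn G k ≤ (k + 1) * S.card :=
    Nat.sInf_le ⟨(k + 1) • S.val, by simp, hS.isKrPDS_nsmul k⟩
  rw [le_div_iff₀ (by norm_num)]
  have h : rpdn G k * 3 ≤ (k + 1) * Fintype.card V := by nlinarith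
  exact_mod_cast h
end

section
/- Let G be the complete multipartite graph K_{3,3,...,3} with m partite sets, each of size 3, for any m ≥ 2. Then γ_P(G) = 2 and every 2-element subset of V(G) is a power dominating set of G; in particular #(G) = |V(G)| = 3m. -/
theorem isPDS_iff {V : Type*} {G : SimpleGraph V} {S : Set V} :
    IsPDS G S ↔ ∀ T : Set V, (∀ s ∈ S, s ∈ T ∧ ∀ w, G.Adj s w → w ∈ T) →
      ForcingClosed G T → ∀ x, x ∈ T := by
  simp only [IsPDS, observedSet, Set.eq_univ_iff_forall, Set.mem_sInter, Set.mem_ofPred_eq, and_imp]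
  exact ⟨fun h T h₁ h₂ x => h x T h₁ h₂, fun h x T h₁ h₂ => h T h₁ h₂ x⟩

/-- Two distinct vertices power dominate `K_{3,…,3}`. -/
theorem isPDS_completeMultipartiteGraph_of_card_eq_two {ι : Type*} [Nontrivial ι]
    (S : Finset ((_ : ι) × Fin 3)) (hS : S.card = 2) :
    IsPDS (SimpleGraph.completeMultipartiteGraph (fun _ : ι => Fin 3)) ↑S := by
  classical
  obtain ⟨⟨i, p⟩, ⟨j, q⟩, hab, rfl⟩ := Finset.card_eq_two.mp hS
  rw [isPDS_iff]
  rintro T hT hF ⟨k, r⟩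
  obtain ⟨ha, hNa⟩ := hT ⟨i, p⟩ (by simp)
  obtain ⟨hb, hNb⟩ := hT ⟨j, q⟩ (by simp)
  by_cases hik : i = k
  swap
  · exact hNa _ hik
  by_cases hjk : j = k
  swap
  · exact hNb _ hjk
  subst hik hjk
  by_contra hr
  have hrp : r ≠ p := by rintro rfl; exact hr ha
  have hrq : r ≠ q := by rintro rfl; exact hr hb
  have hpq : p ≠ q := by rintro rfl; exact hab rfl
  obtain ⟨l, hl⟩ := exists_ne j
  refine hr (hF ⟨l, 0⟩ (hNa _ hl.symm) _ hl ?_)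
  rintro ⟨n, s⟩ - hu
  by_cases hn : j = n
  swap
  · exact absurd (hNa ⟨n, s⟩ hn) hu
  subst hn
  have hsp : s ≠ p := by rintro rfl; exact hu ha
  have hsq : s ≠ q := by rintro rfl; exact hu hb
  have hsr : s = r := by omega
  rw [hsr]

/-- A power dominating set of `K_{3,…,3}` has at least two vertices. -/
theorem two_le_card_of_isPDS_completeMultipartiteGraph {ι : Type*} [Nonempty ι]
    (S : Finset ((_ : ι) × Fin 3))
    (hS : IsPDS (SimpleGraph.completeMultipartiteGraph (fun _ : ι => Fin 3)) ↑S) :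
    2 ≤ S.card := by
  by_contra! hlt
  have : Nonempty ((_ : ι) × Fin 3) := ⟨⟨Classical.arbitrary ι, 0⟩⟩
  obtain ⟨⟨i, p⟩, ha⟩ := Finset.card_le_one_iff_subset_singleton.mp (Nat.le_of_lt_succ hlt)
  rw [isPDS_iff] at hS
  have h := hS {x | x = ⟨i, p⟩ ∨ i ≠ x.1} ?_ ?_ ⟨i, p + 1⟩
  · simp at h
  · intro s hs
    obtain rfl := Finset.mem_singleton.mp (ha hs)
    exact ⟨Or.inl rfl, fun w hw => Or.inr hw⟩
  · rintro v - ⟨j, r⟩ (hvw : v.1 ≠ j) hu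
    by_contra hw
    simp only [Set.mem_ofPred_eq, not_or, not_not] at hw
    obtain ⟨hne, rfl⟩ := hw
    have hrp : r ≠ p := by rintro rfl; exact hne rfl
    obtain ⟨s, hsp, hsr⟩ : ∃ s : Fin 3, s ≠ p ∧ s ≠ r := by
      clear * -; decide +revert
    have h := hu ⟨i, s⟩ hvw (by simp [hsp])
    simp [hsr] at h


/-- Proposition: for the complete multipartite graph `K_{3,3,…,3}` with `m ≥ 2`
partite sets of size 3, `γ_P = 2` and every 2-element vertex subset is a power
dominating set; in particular `#(G) = |V(G)| = 3m`. -/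
theorem multipartite333 (m : ℕ) (hm : 2 ≤ m) :
    pdn (SimpleGraph.completeMultipartiteGraph (fun _ : Fin m => Fin 3)) = 2 ∧
    (∀ S : Finset ((_ : Fin m) × Fin 3), S.card = 2 →
      IsPDS (SimpleGraph.completeMultipartiteGraph (fun _ : Fin m => Fin 3)) ↑S) ∧
    Fintype.card ((_ : Fin m) × Fin 3) = 3 * m := by
  have : Nontrivial (Fin m) := Fin.nontrivial_iff_two_le.mpr hm
  obtain ⟨i, j, hij⟩ := exists_pair_ne (Fin m)
  have hS : ({⟨i, 0⟩, ⟨j, 0⟩} : Finset ((_ : Fin m) × Fin 3)).card = 2 :=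
    Finset.card_pair (by simp [hij])
  have hmem := isPDS_completeMultipartiteGraph_of_card_eq_two _ hS
  refine ⟨le_antisymm (Nat.sInf_le ⟨_, hS, hmem⟩) (le_csInf ⟨2, _, hS, hmem⟩ ?_),
    isPDS_completeMultipartiteGraph_of_card_eq_two, ?_⟩
  · rintro n ⟨S, rfl, h⟩
    exact two_le_card_of_isPDS_completeMultipartiteGraph S h
  · simp [mul_comm]
end

section
/- Let G be a connected finite simple graph on n ≥ 6 vertices with γ_P(G) ≥ 2 such that every subset of V(G) of cardinality γ_P(G) is a power dominating set (i.e., #(G) = n). Then the minimum degree of G satisfies δ(G) ≥ 3. -/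
theorem subset_observedSet {V : Type*} (G : SimpleGraph V) {S : Set V} {s : V} (hs : s ∈ S) :
    s ∈ observedSet G S :=
  fun _ hT => (hT.1 s hs).1

theorem adj_mem_observedSet {V : Type*} (G : SimpleGraph V) {S : Set V} {s w : V} (hs : s ∈ S)
    (hw : G.Adj s w) : w ∈ observedSet G S :=
  fun _ hT => (hT.1 s hs).2 w hw

theorem forcingClosed_observedSet {V : Type*} (G : SimpleGraph V) (S : Set V) :
    ForcingClosed G (observedSet G S) :=
  fun v hv w hw huniq T hT =>
    hT.2 v (hv T hT) w hw fun u hu huT => huniq u hu fun h => huT (h T hT)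

theorem observedSet_subset {V : Type*} {G : SimpleGraph V} {S T : Set V}
    (hS : ∀ s ∈ S, s ∈ T ∧ ∀ w, G.Adj s w → w ∈ T) (hT : ForcingClosed G T) :
    observedSet G S ⊆ T :=
  fun _ hx => hx T ⟨hS, hT⟩

/-- A vertex of degree at most two with a neighbor in a power dominating set is redundant. -/
theorem IsPDS.of_insert {V : Type*} {G : SimpleGraph V} {S : Set V} {v a : V}
    [Fintype (G.neighborSet v)] (h : IsPDS G (insert v S)) (ha : a ∈ S) (hva : G.Adj v a)
    (hdeg : G.degree v ≤ 2) : IsPDS G S := by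
  classical
  refine Set.eq_univ_of_univ_subset (h.symm.subset.trans
    (observedSet_subset ?_ (forcingClosed_observedSet G S)))
  rintro s (rfl | hs)
  · have hmem := adj_mem_observedSet G ha hva.symm
    refine ⟨hmem, fun w hw => ?_⟩
    by_contra hwS
    refine hwS (forcingClosed_observedSet G S _ hmem w hw fun u hu huS => ?_)
    by_contra huw
    have hne : ∀ x, x ∉ observedSet G S → a ≠ x := by
      rintro _ hx rfl
      exact hx (subset_observedSet G ha)
    have hsub : {a, u, w} ⊆ G.neighborFinset s := by
      simp [Finset.insert_subset_iff, hva, hu, hw]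
    have hcard := Finset.card_le_card hsub
    rw [Finset.card_eq_three.mpr ⟨a, u, w, hne u huS, hne w hwS, huw, rfl⟩,
      G.card_neighborFinset_eq_degree] at hcard
    omega
  · exact ⟨subset_observedSet G hs, fun w hw => adj_mem_observedSet G hs hw⟩

theorem pdn_le_card {V : Type*} [Fintype V] (G : SimpleGraph V) : pdn G ≤ Fintype.card V := by
  refine Nat.sInf_le ⟨Finset.univ, Finset.card_univ, ?_⟩
  exact Set.eq_univ_of_forall fun x => subset_observedSet G (by simp)

/-- Lemma: let `G` be connected on `n ≥ 6` vertices with `γ_P(G) ≥ 2` such that every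
subset of cardinality `γ_P(G)` is a power dominating set (i.e. `#(G) = n`).
Then `δ(G) ≥ 3`. -/
theorem minDegree_ge_three {V : Type*} [Fintype V] (G : SimpleGraph V)
    [DecidableRel G.Adj]
    (hconn : G.Connected) (hn : 6 ≤ Fintype.card V) (hpd : 2 ≤ pdn G)
    (hall : ∀ A : Finset V, A.card = pdn G → IsPDS G ↑A) :
    3 ≤ G.minDegree := by
  classical
  have : Nontrivial V := Fintype.one_lt_card_iff_nontrivial.mp (by omega)
  refine G.le_minDegree_of_forall_le_degree 3 fun v => ?_
  by_contra! hdeg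
  obtain ⟨a, hva⟩ := hconn.preconnected.exists_adj_of_nontrivial v
  obtain ⟨S, haS, hSv, hcard⟩ := Finset.exists_subsuperset_card_eq (n := pdn G - 1)
    (show {a} ⊆ Finset.univ.erase v by simp [hva.ne'])
    (by rw [Finset.card_singleton]; omega)
    (by
      have := pdn_le_card G
      rw [Finset.card_erase_of_mem (Finset.mem_univ v), Finset.card_univ]
      omega)
  have hvS : v ∉ S := fun h => Finset.notMem_erase v _ (hSv h)
  have hins : IsPDS G (insert v (S : Set V)) := by
    rw [← Finset.coe_insert]
    exact hall _ (by rw [Finset.card_insert_of_notMem hvS]; omega)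
  have hS : IsPDS G (S : Set V) :=
    hins.of_insert (Finset.singleton_subset_iff.mp haS) hva (by omega)
  have : pdn G ≤ pdn G - 1 := Nat.sInf_le ⟨S, hcard, hS⟩
  omega
end
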